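/- arXiv:1211.7195 — 2 statements merged into one kernel-verified Lean document; each statement's English description precedes it below -/
import Mathlib

section
/- Let R > 0 and let u₀ ∈ 𝓗² satisfy Θ_R u₀ = u₀ and ‖u₁(0)‖² + ‖u₂(0)‖² = 1; let u be the solution of the nonlinear Landau–Zener system with datum u₀, v its gauge transform, and σ(s) = s + m(u(s)). Define m̃(x,y) = (δ/2)(f₁(x,y) − f₂(x,y)) and m̲(s) = (∂₁m̃ − ∂₂m̃)(‖v₁(s)‖², ‖v₂(s)‖²). Then σ′(s) = 1 − 2·m̲(s)·Im⟨v₁(s), Gv₂(s)⟩ for all s ∈ ℝ, and there exists a constant C > 0 (depending only on R and the fixed data θ, δ, f₁, f₂, G) such that |σ′(s)| ≤ C and |σ″(s) − 4s·m̲(s)·Re⟨v₁(s), Gv₂(s)⟩| ≤ C for all s ∈ ℝ. -/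
open ContinuousLinearMap Complex Filter Topology
open scoped InnerProductSpace

noncomputable section

variable {H : Type*} [NormedAddCommGroup H] [InnerProductSpace ℂ H] [CompleteSpace H]

/-- Functional calculus `χ(A)` of a selfadjoint operator `A` for a complex-valued
function `χ : ℝ → ℂ` (defined via the real continuous functional calculus applied to
the real and imaginary parts of `χ`). -/
def fc (χ : ℝ → ℂ) (A : H →L[ℂ] H) : H →L[ℂ] H :=
  cfc (fun x : ℝ => (χ x).re) A + Complex.I • cfc (fun x : ℝ => (χ x).im) A

/-- The commutation assumption: for every continuous `χ : ℝ → ℂ`,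
`χ(GG*)G = Gχ(G*G)` and `χ(G*G)G* = G*χ(GG*)`. -/
def CommHyp (G : H →L[ℂ] H) : Prop :=
  ∀ χ : ℝ → ℂ, Continuous χ →
    (fc χ (G * ContinuousLinearMap.adjoint G)) ∘L G
        = G ∘L (fc χ (ContinuousLinearMap.adjoint G * G)) ∧
    (fc χ (ContinuousLinearMap.adjoint G * G)) ∘L ContinuousLinearMap.adjoint G
        = ContinuousLinearMap.adjoint G ∘L (fc χ (G * ContinuousLinearMap.adjoint G))

/-- The equivalence between `𝓗²` (with its Hilbert space structure) and `𝓗 × 𝓗`. -/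
def eqv : WithLp 2 (H × H) ≃L[ℂ] H × H := WithLp.prodContinuousLinearEquiv 2 ℂ H H

/-- The operator `V(s)(w₁,w₂) = (s·w₁ + Gw₂, G*w₁ − s·w₂)` on `𝓗²`. -/
def Vop (G : H →L[ℂ] H) (s : ℝ) : WithLp 2 (H × H) →L[ℂ] WithLp 2 (H × H) :=
  (eqv (H := H)).symm.toContinuousLinearMap ∘L
    ((((s : ℂ) • ContinuousLinearMap.fst ℂ H H + G ∘L ContinuousLinearMap.snd ℂ H H)).prod
      ((ContinuousLinearMap.adjoint G) ∘L ContinuousLinearMap.fst ℂ H H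
        - (s : ℂ) • ContinuousLinearMap.snd ℂ H H)) ∘L
    (eqv (H := H)).toContinuousLinearMap

/-- `F₁(u) = f₁(‖u₁‖², ‖u₂‖²)`. -/
def F1 (f₁ : ℝ × ℝ → ℝ) (u : WithLp 2 (H × H)) : ℝ := f₁ (‖u.fst‖ ^ 2, ‖u.snd‖ ^ 2)

/-- `F₂(u) = f₂(‖u₁‖², ‖u₂‖²)`. -/
def F2 (f₂ : ℝ × ℝ → ℝ) (u : WithLp 2 (H × H)) : ℝ := f₂ (‖u.fst‖ ^ 2, ‖u.snd‖ ^ 2)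

/-- The nonlinear term `F(u)u = (F₁(u)u₁, F₂(u)u₂)`. -/
def nlt (f₁ f₂ : ℝ × ℝ → ℝ) (u : WithLp 2 (H × H)) : WithLp 2 (H × H) :=
  (WithLp.equiv 2 (H × H)).symm ((F1 f₁ u) • u.fst, (F2 f₂ u) • u.snd)

/-- `u` is a (global, `C¹`) solution of `−i u′(s) = V(s)u(s) + δ F(u(s))u(s)`:
equivalently, `u′(s) = i (V(s)u(s) + δ F(u(s))u(s))` for all `s`. -/
def IsLZSol (G : H →L[ℂ] H) (δ : ℝ) (f₁ f₂ : ℝ × ℝ → ℝ) (u : ℝ → WithLp 2 (H × H)) : Prop :=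
  ∀ s : ℝ, HasDerivAt u (Complex.I • (Vop G s (u s) + δ • nlt f₁ f₂ (u s))) s

/-- `f ∈ C²(ℝ²;ℝ)` with bounded second derivative. -/
def C2Bdd (f : ℝ × ℝ → ℝ) : Prop :=
  ContDiff ℝ 2 f ∧ ∃ C : ℝ, ∀ p : ℝ × ℝ, ‖iteratedFDeriv ℝ 2 f p‖ ≤ C

/-- `θ ∈ C_c^∞(ℝ;ℝ)`, `0 ≤ θ ≤ 1`, `θ = 1` on `(−1/2,1/2)` and `θ = 0` outside `[−1,1]`. -/
def IsCutoff (θ : ℝ → ℝ) : Prop :=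
  ContDiff ℝ (⊤ : ℕ∞) θ ∧ HasCompactSupport θ ∧ (∀ x, 0 ≤ θ x ∧ θ x ≤ 1) ∧
    (∀ x, |x| < 1/2 → θ x = 1) ∧ (∀ x, 1 < |x| → θ x = 0)

/-- The cutoff operator `Θ_R = diag(θ(GG*/R²), θ(G*G/R²))`. -/
def Theta (G : H →L[ℂ] H) (θ : ℝ → ℝ) (R : ℝ) :
    WithLp 2 (H × H) →L[ℂ] WithLp 2 (H × H) :=
  (eqv (H := H)).symm.toContinuousLinearMap ∘L
    ((cfc (fun x : ℝ => θ (x / R ^ 2)) (G * ContinuousLinearMap.adjoint G)).prodMap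
      (cfc (fun x : ℝ => θ (x / R ^ 2)) (ContinuousLinearMap.adjoint G * G))) ∘L
    (eqv (H := H)).toContinuousLinearMap

/-- The phase `φ(s,λ) = s²/2 + (λ/2)·log|s|`. -/
def phase (s lam : ℝ) : ℝ := s ^ 2 / 2 + lam / 2 * Real.log |s|

/-- The unitary operator `e^{iφ(s,GG*)}` on `𝓗`. -/
def ePhaseP (G : H →L[ℂ] H) (s : ℝ) : H →L[ℂ] H :=
  fc (fun lam => Complex.exp (Complex.I * (phase s lam))) (G * ContinuousLinearMap.adjoint G)

/-- The unitary operator `e^{−iφ(s,G*G)}` on `𝓗`. -/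
def ePhaseM (G : H →L[ℂ] H) (s : ℝ) : H →L[ℂ] H :=
  fc (fun lam => Complex.exp (-(Complex.I * (phase s lam))))
    (ContinuousLinearMap.adjoint G * G)

/-- The model asymptotic first component `e^{iδF₁(ω)s + iϕ}·e^{iφ(s,GG*)}ω₁`. -/
def asym1 (G : H →L[ℂ] H) (δ : ℝ) (f₁ : ℝ × ℝ → ℝ) (ω : WithLp 2 (H × H)) (ϕ : ℝ)
    (s : ℝ) : H :=
  Complex.exp (Complex.I * (δ * F1 f₁ ω * s + ϕ)) • (ePhaseP G s ω.fst)

/-- The model asymptotic second component `e^{iδF₂(ω)s − iϕ}·e^{−iφ(s,G*G)}ω₂`. -/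
def asym2 (G : H →L[ℂ] H) (δ : ℝ) (f₂ : ℝ × ℝ → ℝ) (ω : WithLp 2 (H × H)) (ϕ : ℝ)
    (s : ℝ) : H :=
  Complex.exp (Complex.I * (δ * F2 f₂ ω * s - ϕ)) • (ePhaseM G s ω.snd)

/-- `α` is the incoming scattering state (at `s → −∞`) of `u`, with phase shift `ϕ`. -/
def Incoming (G : H →L[ℂ] H) (δ : ℝ) (f₁ f₂ : ℝ × ℝ → ℝ) (α : WithLp 2 (H × H)) (ϕ : ℝ)
    (u : ℝ → WithLp 2 (H × H)) : Prop :=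
  Tendsto (fun s => ‖(u s).fst - asym1 G δ f₁ α ϕ s‖ + ‖(u s).snd - asym2 G δ f₂ α ϕ s‖)
    atBot (𝓝 0)

/-- `ω` is the outgoing scattering state (at `s → +∞`) of `u`, with phase shift `ϕ`. -/
def Outgoing (G : H →L[ℂ] H) (δ : ℝ) (f₁ f₂ : ℝ × ℝ → ℝ) (ω : WithLp 2 (H × H)) (ϕ : ℝ)
    (u : ℝ → WithLp 2 (H × H)) : Prop :=
  Tendsto (fun s => ‖(u s).fst - asym1 G δ f₁ ω ϕ s‖ + ‖(u s).snd - asym2 G δ f₂ ω ϕ s‖)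
    atTop (𝓝 0)

/-- `M(u) = (δ/2)(F₁(u) + F₂(u))`. -/
def Mscal (δ : ℝ) (f₁ f₂ : ℝ × ℝ → ℝ) (u : WithLp 2 (H × H)) : ℝ :=
  δ / 2 * (F1 f₁ u + F2 f₂ u)

/-- `m(u) = (δ/2)(F₁(u) − F₂(u))`. -/
def mscal (δ : ℝ) (f₁ f₂ : ℝ × ℝ → ℝ) (u : WithLp 2 (H × H)) : ℝ :=
  δ / 2 * (F1 f₁ u - F2 f₂ u)

/-- The gauge transform `v(s) = e^{−i∫₀ˢ M(u(τ))dτ}·u(s)`. -/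
def gaugeT (δ : ℝ) (f₁ f₂ : ℝ × ℝ → ℝ) (u : ℝ → WithLp 2 (H × H)) :
    ℝ → WithLp 2 (H × H) :=
  fun s => Complex.exp (-(Complex.I * (∫ τ in (0:ℝ)..s, Mscal δ f₁ f₂ (u τ)))) • u s

/-- `σ(s) = s + m(u(s))`. -/
def sigma (δ : ℝ) (f₁ f₂ : ℝ × ℝ → ℝ) (u : ℝ → WithLp 2 (H × H)) (s : ℝ) : ℝ :=
  s + mscal δ f₁ f₂ (u s)

/-- The operator `Λ_t = diag((t² + GG*)^{1/2}, (t² + G*G)^{1/2})` on `𝓗²`. -/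
def LamOp (G : H →L[ℂ] H) (t : ℝ) : WithLp 2 (H × H) →L[ℂ] WithLp 2 (H × H) :=
  (eqv (H := H)).symm.toContinuousLinearMap ∘L
    ((cfc (fun x : ℝ => Real.sqrt (t ^ 2 + x)) (G * ContinuousLinearMap.adjoint G)).prodMap
      (cfc (fun x : ℝ => Real.sqrt (t ^ 2 + x)) (ContinuousLinearMap.adjoint G * G))) ∘L
    (eqv (H := H)).toContinuousLinearMap

/-- The operator `Λ_t⁻¹ = diag((t² + GG*)^{-1/2}, (t² + G*G)^{-1/2})` on `𝓗²`. -/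
def LamInv (G : H →L[ℂ] H) (t : ℝ) : WithLp 2 (H × H) →L[ℂ] WithLp 2 (H × H) :=
  (eqv (H := H)).symm.toContinuousLinearMap ∘L
    ((cfc (fun x : ℝ => (Real.sqrt (t ^ 2 + x))⁻¹)
        (G * ContinuousLinearMap.adjoint G)).prodMap
      (cfc (fun x : ℝ => (Real.sqrt (t ^ 2 + x))⁻¹)
        (ContinuousLinearMap.adjoint G * G))) ∘L
    (eqv (H := H)).toContinuousLinearMap

/-- The projection `Π_t^+ = (1/2)(Id + Λ_t⁻¹V(t))`. -/
def PiP (G : H →L[ℂ] H) (t : ℝ) : WithLp 2 (H × H) →L[ℂ] WithLp 2 (H × H) :=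
  (2 : ℂ)⁻¹ • (1 + LamInv G t ∘L Vop G t)

/-- The projection `Π_t^- = (1/2)(Id − Λ_t⁻¹V(t))`. -/
def PiM (G : H →L[ℂ] H) (t : ℝ) : WithLp 2 (H × H) →L[ℂ] WithLp 2 (H × H) :=
  (2 : ℂ)⁻¹ • (1 - LamInv G t ∘L Vop G t)

/-- `m̃(x,y) = (δ/2)(f₁(x,y) − f₂(x,y))`. -/
def mtilde (δ : ℝ) (f₁ f₂ : ℝ × ℝ → ℝ) : ℝ × ℝ → ℝ := fun p => δ / 2 * (f₁ p - f₂ p)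

/-- `m̲(s) = (∂₁m̃ − ∂₂m̃)(‖v₁(s)‖², ‖v₂(s)‖²)`. -/
def mbar (δ : ℝ) (f₁ f₂ : ℝ × ℝ → ℝ) (v : ℝ → WithLp 2 (H × H)) (s : ℝ) : ℝ :=
  fderiv ℝ (mtilde δ f₁ f₂) (‖(v s).fst‖ ^ 2, ‖(v s).snd‖ ^ 2) (1, 0) -
    fderiv ℝ (mtilde δ f₁ f₂) (‖(v s).fst‖ ^ 2, ‖(v s).snd‖ ^ 2) (0, 1)


/-- The operator `A(a,b,c,d)(w₁,w₂) = (a(GG*)w₁ + b(GG*)Gw₂, c(G*G)G*w₁ + d(G*G)w₂)`. -/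
def Aop (G : H →L[ℂ] H) (a b c d : ℝ → ℂ) :
    WithLp 2 (H × H) →L[ℂ] WithLp 2 (H × H) :=
  (eqv (H := H)).symm.toContinuousLinearMap ∘L
    (((fc a (G * ContinuousLinearMap.adjoint G)) ∘L ContinuousLinearMap.fst ℂ H H
        + (fc b (G * ContinuousLinearMap.adjoint G)) ∘L G ∘L ContinuousLinearMap.snd ℂ H H).prod
      ((fc c (ContinuousLinearMap.adjoint G * G)) ∘L (ContinuousLinearMap.adjoint G)
          ∘L ContinuousLinearMap.fst ℂ H H
        + (fc d (ContinuousLinearMap.adjoint G * G)) ∘L ContinuousLinearMap.snd ℂ H H)) ∘L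
    (eqv (H := H)).toContinuousLinearMap

/-- The operator `𝒦(w₁,w₂) = (−Gw₂, G*w₁)` on `𝓗²`. -/
def Kcal (G : H →L[ℂ] H) : WithLp 2 (H × H) →L[ℂ] WithLp 2 (H × H) :=
  (eqv (H := H)).symm.toContinuousLinearMap ∘L
    ((-(G ∘L ContinuousLinearMap.snd ℂ H H)).prod
      ((ContinuousLinearMap.adjoint G) ∘L ContinuousLinearMap.fst ℂ H H)) ∘L
    (eqv (H := H)).toContinuousLinearMap


lemma IsLZSol.hasDerivAt_fst {G : H →L[ℂ] H} {δ : ℝ} {f₁ f₂ : ℝ × ℝ → ℝ}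
    {u : ℝ → WithLp 2 (H × H)} (hu : IsLZSol G δ f₁ f₂ u) (s : ℝ) :
    HasDerivAt (fun t => (u t).fst)
      (I • (((s + δ * F1 f₁ (u s) : ℝ) : ℂ) • (u s).fst + G (u s).snd)) s := by
  have h := ((WithLp.fstL 2 ℂ H H).restrictScalars ℝ).hasFDerivAt.comp_hasDerivAt s (hu s)
  refine h.congr_deriv ?_
  change I • (((s : ℂ) • (u s).fst + G (u s).snd) + δ • (F1 f₁ (u s) • (u s).fst)) = _
  simp only [← Complex.coe_smul, smul_smul]
  push_cast
  module

lemma IsLZSol.hasDerivAt_snd {G : H →L[ℂ] H} {δ : ℝ} {f₁ f₂ : ℝ × ℝ → ℝ}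
    {u : ℝ → WithLp 2 (H × H)} (hu : IsLZSol G δ f₁ f₂ u) (s : ℝ) :
    HasDerivAt (fun t => (u t).snd)
      (I • (adjoint G (u s).fst + ((-s + δ * F2 f₂ (u s) : ℝ) : ℂ) • (u s).snd)) s := by
  have h := ((WithLp.sndL 2 ℂ H H).restrictScalars ℝ).hasFDerivAt.comp_hasDerivAt s (hu s)
  refine h.congr_deriv ?_
  change I • ((adjoint G (u s).fst - (s : ℂ) • (u s).snd) + δ • (F2 f₂ (u s) • (u s).snd)) = _
  simp only [← Complex.coe_smul, smul_smul]
  push_cast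
  module

lemma HasDerivAt.norm_sq_complex {a : ℝ → H} {a' : H} {s : ℝ} (ha : HasDerivAt a a' s) :
    HasDerivAt (fun t => ‖a t‖ ^ 2) (2 * (⟪a s, a'⟫_ℂ).re) s := by
  have h := reCLM.hasFDerivAt.comp_hasDerivAt s (ha.inner ℂ ha)
  have e : (reCLM ∘ fun t => ⟪a t, a t⟫_ℂ) = fun t => ‖a t‖ ^ 2 := by
    funext t
    simp [inner_self_eq_norm_sq_to_K, ← Complex.ofReal_pow]
  rw [e] at h
  refine h.congr_deriv ?_
  change (⟪a s, a'⟫_ℂ + ⟪a', a s⟫_ℂ).re = _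
  rw [← inner_conj_symm a' (a s), Complex.add_re, Complex.conj_re]
  ring

lemma IsLZSol.hasDerivAt_norm_sq_fst {G : H →L[ℂ] H} {δ : ℝ} {f₁ f₂ : ℝ × ℝ → ℝ}
    {u : ℝ → WithLp 2 (H × H)} (hu : IsLZSol G δ f₁ f₂ u) (s : ℝ) :
    HasDerivAt (fun t => ‖(u t).fst‖ ^ 2) (-2 * (⟪(u s).fst, G (u s).snd⟫_ℂ).im) s := by
  refine (hu.hasDerivAt_fst s).norm_sq_complex.congr_deriv ?_
  simp [inner_self_eq_norm_sq_to_K, ← Complex.ofReal_pow]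

lemma IsLZSol.hasDerivAt_norm_sq_snd {G : H →L[ℂ] H} {δ : ℝ} {f₁ f₂ : ℝ × ℝ → ℝ}
    {u : ℝ → WithLp 2 (H × H)} (hu : IsLZSol G δ f₁ f₂ u) (s : ℝ) :
    HasDerivAt (fun t => ‖(u t).snd‖ ^ 2) (2 * (⟪(u s).fst, G (u s).snd⟫_ℂ).im) s := by
  refine (hu.hasDerivAt_snd s).norm_sq_complex.congr_deriv ?_
  rw [← inner_conj_symm (u s).fst, Complex.conj_im]
  simp [inner_self_eq_norm_sq_to_K, ← Complex.ofReal_pow, adjoint_inner_right]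

lemma IsLZSol.norm_sq_add_norm_sq {G : H →L[ℂ] H} {δ : ℝ} {f₁ f₂ : ℝ × ℝ → ℝ}
    {u : ℝ → WithLp 2 (H × H)} (hu : IsLZSol G δ f₁ f₂ u) (s : ℝ) :
    ‖(u s).fst‖ ^ 2 + ‖(u s).snd‖ ^ 2 = ‖(u 0).fst‖ ^ 2 + ‖(u 0).snd‖ ^ 2 := by
  have h (t : ℝ) : HasDerivAt (fun t => ‖(u t).fst‖ ^ 2 + ‖(u t).snd‖ ^ 2) 0 t :=
    ((hu.hasDerivAt_norm_sq_fst t).add (hu.hasDerivAt_norm_sq_snd t)).congr_deriv (by ring)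
  exact is_const_of_deriv_eq_zero (fun t => (h t).differentiableAt) (fun t => (h t).deriv) s 0

lemma IsLZSol.hasDerivAt_im_inner {G : H →L[ℂ] H} {δ : ℝ} {f₁ f₂ : ℝ × ℝ → ℝ}
    {u : ℝ → WithLp 2 (H × H)} (hu : IsLZSol G δ f₁ f₂ u) (s : ℝ) :
    HasDerivAt (fun t => (⟪(u t).fst, G (u t).snd⟫_ℂ).im)
      (-2 * (s + mscal δ f₁ f₂ (u s)) * (⟪(u s).fst, G (u s).snd⟫_ℂ).re
        + ‖adjoint G (u s).fst‖ ^ 2 - ‖G (u s).snd‖ ^ 2) s := by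
  have hG := (G.restrictScalars ℝ).hasFDerivAt.comp_hasDerivAt s (hu.hasDerivAt_snd s)
  have h := imCLM.hasFDerivAt.comp_hasDerivAt s ((hu.hasDerivAt_fst s).inner ℂ hG)
  refine h.congr_deriv ?_
  have hq : ⟪(u s).fst, G (adjoint G (u s).fst)⟫_ℂ = ((‖adjoint G (u s).fst‖ ^ 2 : ℝ) : ℂ) := by
    rw [← adjoint_inner_left, inner_self_eq_norm_sq_to_K]
    simp
  simp [inner_add_right, inner_add_left, inner_smul_right, inner_smul_left, hq,
    inner_self_eq_norm_sq_to_K, ← Complex.ofReal_pow, mscal]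
  ring

lemma norm_inner_apply_le {G : H →L[ℂ] H} {a b : H} (ha : ‖a‖ ≤ 1) (hb : ‖b‖ ≤ 1) :
    ‖⟪a, G b⟫_ℂ‖ ≤ ‖G‖ :=
  calc ‖⟪a, G b⟫_ℂ‖ ≤ ‖a‖ * ‖G b‖ := norm_inner_le_norm _ _
    _ ≤ 1 * ‖G‖ := by
      gcongr
      exact G.unit_le_opNorm b hb
    _ = ‖G‖ := one_mul _

lemma norm_exp_neg_I_mul_ofReal (r : ℝ) : ‖Complex.exp (-(I * r))‖ = 1 := by
  rw [show -(I * (r : ℂ)) = ((-r : ℝ) : ℂ) * I by push_cast; ring, norm_exp_ofReal_mul_I]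

lemma norm_gaugeT_fst (δ : ℝ) (f₁ f₂ : ℝ × ℝ → ℝ) (u : ℝ → WithLp 2 (H × H)) (s : ℝ) :
    ‖(gaugeT δ f₁ f₂ u s).fst‖ = ‖(u s).fst‖ := by
  simp only [gaugeT, WithLp.smul_fst, norm_smul, norm_exp_neg_I_mul_ofReal, one_mul]

lemma norm_gaugeT_snd (δ : ℝ) (f₁ f₂ : ℝ × ℝ → ℝ) (u : ℝ → WithLp 2 (H × H)) (s : ℝ) :
    ‖(gaugeT δ f₁ f₂ u s).snd‖ = ‖(u s).snd‖ := by
  simp only [gaugeT, WithLp.smul_snd, norm_smul, norm_exp_neg_I_mul_ofReal, one_mul]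

lemma inner_gaugeT (G : H →L[ℂ] H) (δ : ℝ) (f₁ f₂ : ℝ × ℝ → ℝ) (u : ℝ → WithLp 2 (H × H))
    (s : ℝ) :
    ⟪(gaugeT δ f₁ f₂ u s).fst, G (gaugeT δ f₁ f₂ u s).snd⟫_ℂ = ⟪(u s).fst, G (u s).snd⟫_ℂ := by
  simp only [gaugeT, WithLp.smul_fst, WithLp.smul_snd, map_smul, inner_smul_left,
    inner_smul_right, ← mul_assoc]
  rw [Complex.mul_conj, Complex.normSq_eq_norm_sq, norm_exp_neg_I_mul_ofReal]
  simp

lemma IsLZSol.hasDerivAt_comp_norm_sq {G : H →L[ℂ] H} {δ : ℝ} {f₁ f₂ : ℝ × ℝ → ℝ}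
    {u : ℝ → WithLp 2 (H × H)} (hu : IsLZSol G δ f₁ f₂ u) {g : ℝ × ℝ → ℝ}
    (hg : Differentiable ℝ g) (s : ℝ) :
    HasDerivAt (fun t => g (‖(u t).fst‖ ^ 2, ‖(u t).snd‖ ^ 2))
      (-2 * (⟪(u s).fst, G (u s).snd⟫_ℂ).im *
        fderiv ℝ g (‖(u s).fst‖ ^ 2, ‖(u s).snd‖ ^ 2) (1, -1)) s := by
  have h := (hg (‖(u s).fst‖ ^ 2, ‖(u s).snd‖ ^ 2)).hasFDerivAt.comp_hasDerivAt s
    ((hu.hasDerivAt_norm_sq_fst s).prodMk (hu.hasDerivAt_norm_sq_snd s))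
  refine h.congr_deriv ?_
  rw [← smul_eq_mul (_ * _), ← map_smul]
  simp

lemma mbar_gaugeT (δ : ℝ) (f₁ f₂ : ℝ × ℝ → ℝ) (u : ℝ → WithLp 2 (H × H)) (s : ℝ) :
    mbar δ f₁ f₂ (gaugeT δ f₁ f₂ u) s =
      fderiv ℝ (mtilde δ f₁ f₂) (‖(u s).fst‖ ^ 2, ‖(u s).snd‖ ^ 2) (1, -1) := by
  rw [mbar, norm_gaugeT_fst, norm_gaugeT_snd, ← map_sub]
  simp

lemma contDiff_mtilde {f₁ f₂ : ℝ × ℝ → ℝ} {n : WithTop ℕ∞} (hf₁ : ContDiff ℝ n f₁)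
    (hf₂ : ContDiff ℝ n f₂) (δ : ℝ) : ContDiff ℝ n (mtilde δ f₁ f₂) :=
  contDiff_const.mul (hf₁.sub hf₂)

lemma exists_bound_unit_square {g : ℝ × ℝ → ℝ} (hg : Continuous g) :
    ∃ C, 0 ≤ C ∧ ∀ x y : ℝ, 0 ≤ x → 0 ≤ y → x + y = 1 → |g (x, y)| ≤ C := by
  obtain ⟨C, hC⟩ := (isCompact_Icc.prod isCompact_Icc).exists_bound_of_continuousOn
    (s := Set.Icc (0 : ℝ) 1 ×ˢ Set.Icc (0 : ℝ) 1) hg.continuousOn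
  refine ⟨max C 0, le_max_right _ _, fun x y hx hy hxy => ?_⟩
  exact (hC (x, y) ⟨⟨hx, by linarith⟩, ⟨hy, by linarith⟩⟩).trans (le_max_left _ _)

/-- formula and bounds for `σ′` and `σ″` (Lemma 3.9). -/
theorem stmt_14 (G : H →L[ℂ] H) (hG : CommHyp G) (δ : ℝ) (f₁ f₂ : ℝ × ℝ → ℝ)
    (hf₁ : C2Bdd f₁) (hf₂ : C2Bdd f₂) (θ : ℝ → ℝ) (hθ : IsCutoff θ)
    (R : ℝ) (hR : 0 < R) :
    ∃ C > 0, ∀ u₀ : WithLp 2 (H × H), ∀ u : ℝ → WithLp 2 (H × H),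
      Theta G θ R u₀ = u₀ → ‖u₀.fst‖ ^ 2 + ‖u₀.snd‖ ^ 2 = 1 →
      IsLZSol G δ f₁ f₂ u → u 0 = u₀ →
      ∀ v : ℝ → WithLp 2 (H × H), v = gaugeT δ f₁ f₂ u →
        (∀ s : ℝ, HasDerivAt (sigma δ f₁ f₂ u)
          (1 - 2 * mbar δ f₁ f₂ v s * (⟪(v s).fst, G ((v s).snd)⟫_ℂ).im) s) ∧
        (∀ s : ℝ,
          |1 - 2 * mbar δ f₁ f₂ v s * (⟪(v s).fst, G ((v s).snd)⟫_ℂ).im| ≤ C) ∧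
        ∃ σ'' : ℝ → ℝ,
          (∀ s : ℝ, HasDerivAt
            (fun t : ℝ => 1 - 2 * mbar δ f₁ f₂ v t * (⟪(v t).fst, G ((v t).snd)⟫_ℂ).im)
            (σ'' s) s) ∧
          ∀ s : ℝ,
            |σ'' s - 4 * s * mbar δ f₁ f₂ v s * (⟪(v s).fst, G ((v s).snd)⟫_ℂ).re| ≤ C := by
  have hm : ContDiff ℝ 2 (mtilde δ f₁ f₂) := contDiff_mtilde hf₁.1 hf₂.1 δ
  set n : ℝ × ℝ → ℝ := fun p => fderiv ℝ (mtilde δ f₁ f₂) p (1, -1)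
  have hn1 : ContDiff ℝ 1 n := (hm.fderiv_right (by norm_num)).clm_apply contDiff_const
  have hn2 : Continuous fun p => fderiv ℝ n p (1, -1) :=
    (hn1.continuous_fderiv (by norm_num)).clm_apply continuous_const
  obtain ⟨C₀, hC₀, hb₀⟩ := exists_bound_unit_square hm.continuous
  obtain ⟨C₁, hC₁, hb₁⟩ := exists_bound_unit_square hn1.continuous
  obtain ⟨C₂, hC₂, hb₂⟩ := exists_bound_unit_square hn2
  set K := ‖G‖
  have hK0 : 0 ≤ K := norm_nonneg G
  refine ⟨1 + 2 * C₁ * K + 4 * C₂ * K ^ 2 + 4 * C₁ * C₀ * K + 4 * C₁ * K ^ 2, by positivity, ?_⟩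
  rintro u₀ u - hu₀ hu rfl v rfl
  simp only [inner_gaugeT, mbar_gaugeT]
  have hsum (s : ℝ) := (hu.norm_sq_add_norm_sq s).trans hu₀
  have hfst (s : ℝ) : ‖(u s).fst‖ ≤ 1 := by nlinarith [hsum s, sq_nonneg ‖(u s).snd‖]
  have hsnd (s : ℝ) : ‖(u s).snd‖ ≤ 1 := by nlinarith [hsum s, sq_nonneg ‖(u s).fst‖]
  have him (s : ℝ) : |(⟪(u s).fst, G (u s).snd⟫_ℂ).im| ≤ K :=
    (abs_im_le_norm _).trans (norm_inner_apply_le (hfst s) (hsnd s))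
  have hre (s : ℝ) : |(⟪(u s).fst, G (u s).snd⟫_ℂ).re| ≤ K :=
    (abs_re_le_norm _).trans (norm_inner_apply_le (hfst s) (hsnd s))
  have hbd {g : ℝ × ℝ → ℝ} {C : ℝ}
      (h : ∀ x y : ℝ, 0 ≤ x → 0 ≤ y → x + y = 1 → |g (x, y)| ≤ C) (s : ℝ) :
      |g (‖(u s).fst‖ ^ 2, ‖(u s).snd‖ ^ 2)| ≤ C :=
    h _ _ (sq_nonneg _) (sq_nonneg _) (hsum s)
  refine ⟨fun s => ?_, fun s => ?_, ?_⟩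
  · refine ((hasDerivAt_id s).add (hu.hasDerivAt_comp_norm_sq
      (hm.differentiable (by norm_num)) s)).congr_deriv ?_
    ring
  · have h₁ : |n (‖(u s).fst‖ ^ 2, ‖(u s).snd‖ ^ 2) * (⟪(u s).fst, G (u s).snd⟫_ℂ).im|
        ≤ C₁ * K := by
      rw [abs_mul]
      exact mul_le_mul (hbd hb₁ s) (him s) (abs_nonneg _) hC₁
    have h₂ : 0 ≤ 4 * C₂ * K ^ 2 + 4 * C₁ * C₀ * K + 4 * C₁ * K ^ 2 := by positivity
    rw [abs_le] at h₁ ⊢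
    constructor <;> linarith
  · refine ⟨_, fun s => (((hu.hasDerivAt_comp_norm_sq (hn1.differentiable (by norm_num)) s).const_mul
      2).mul (hu.hasDerivAt_im_inner s)).const_sub 1, fun s => ?_⟩
    have hA : ‖adjoint G (u s).fst‖ ^ 2 ≤ K ^ 2 := by
      gcongr
      exact ((adjoint G).unit_le_opNorm _ (hfst s)).trans_eq (LinearIsometryEquiv.norm_map _ _)
    have hB : ‖G (u s).snd‖ ^ 2 ≤ K ^ 2 := by
      gcongr
      exact G.unit_le_opNorm _ (hsnd s)
    have hm0 := hbd hb₀ s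
    have hm1 := hbd hb₁ s
    have hm2 := hbd (g := fun p => fderiv ℝ n p (1, -1)) hb₂ s
    have hi := him s
    have hr := hre s
    have hms : mscal δ f₁ f₂ (u s) = mtilde δ f₁ f₂ (‖(u s).fst‖ ^ 2, ‖(u s).snd‖ ^ 2) := rfl
    rw [hms]
    set p := (‖(u s).fst‖ ^ 2, ‖(u s).snd‖ ^ 2)
    set b := (⟪(u s).fst, G (u s).snd⟫_ℂ).im
    set a := (⟪(u s).fst, G (u s).snd⟫_ℂ).re
    have hAB : |‖adjoint G (u s).fst‖ ^ 2 - ‖G (u s).snd‖ ^ 2| ≤ K ^ 2 :=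
      abs_sub_le_of_nonneg_of_le (sq_nonneg _) hA (sq_nonneg _) hB
    have h₁ : |fderiv ℝ n p (1, -1) * (b * b)| ≤ C₂ * (K * K) := by
      simp only [abs_mul]
      gcongr
    have h₂ : |n p * (mtilde δ f₁ f₂ p * a)| ≤ C₁ * (C₀ * K) := by
      simp only [abs_mul]
      gcongr
    have h₃ : |n p * (‖adjoint G (u s).fst‖ ^ 2 - ‖G (u s).snd‖ ^ 2)| ≤ C₁ * K ^ 2 := by
      rw [abs_mul]
      gcongr
    have h₄ : 0 ≤ C₁ * K := by positivity
    have h₅ : 0 ≤ C₁ * K ^ 2 := by positivity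
    change |-(2 * (-2 * b * fderiv ℝ n p (1, -1)) * b + 2 * n p * _) - 4 * s * n p * a| ≤ _
    rw [abs_le] at h₁ h₂ h₃ ⊢
    constructor <;> nlinarith

end
end

section
/- Let R > 0 and let u₀ ∈ 𝓗² satisfy Θ_R u₀ = u₀ and ‖u₁(0)‖² + ‖u₂(0)‖² = 1; let u be the solution of the nonlinear Landau–Zener system with datum u₀, with σ(s) = s + m(u(s)). Let K = V(0), and set C̃(s) = Λ(s)^{-1}Π⁻(s)KΘ_RΠ⁺(s) and B̃(s) = (1/2)Λ(s)^{-1}C̃(s). Then: (i) Π⁺(s)C̃(s)Π⁺(s) = Π⁻(s)C̃(s)Π⁻(s) = 0 (antidiagonality); (ii) the skew-adjoint part satisfies (C̃(s) − C̃(s)*)/2 = (σ(s)/2)·Λ(s)^{-2}·Θ_R·𝒦, where 𝒦 is the operator on 𝓗² given by 𝒦(w₁,w₂) = (−Gw₂, G*w₁); (iii) there is a constant C₀ > 0 (depending only on R and the fixed data θ, δ, f₁, f₂, G) such that for all |s| ≥ 1 the operator norms satisfy ‖C̃(s)‖ ≤ C₀/|s|, ‖B̃(s)‖ ≤ C₀/s²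 and ‖B̃′(s)‖ ≤ C₀/|s|³. -/
open ContinuousLinearMap Complex Filter Topology
open scoped InnerProductSpace

noncomputable section

variable {H : Type*} [NormedAddCommGroup H] [InnerProductSpace ℂ H] [CompleteSpace H]

/-- `C̃(s) = Λ(s)⁻¹Π⁻(s)KΘ_RΠ⁺(s)` with `K = V(0)`. -/
def Ctil (G : H →L[ℂ] H) (θ : ℝ → ℝ) (R δ : ℝ) (f₁ f₂ : ℝ × ℝ → ℝ)
    (u : ℝ → WithLp 2 (H × H)) :
    ℝ → (WithLp 2 (H × H) →L[ℂ] WithLp 2 (H × H)) :=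
  fun s => LamInv G (sigma δ f₁ f₂ u s) ∘L PiM G (sigma δ f₁ f₂ u s) ∘L Vop G 0
    ∘L Theta G θ R ∘L PiP G (sigma δ f₁ f₂ u s)

/-- `B̃(s) = (1/2)Λ(s)⁻¹C̃(s)`. -/
def Btil (G : H →L[ℂ] H) (θ : ℝ → ℝ) (R δ : ℝ) (f₁ f₂ : ℝ × ℝ → ℝ)
    (u : ℝ → WithLp 2 (H × H)) :
    ℝ → (WithLp 2 (H × H) →L[ℂ] WithLp 2 (H × H)) :=
  fun s => (2 : ℂ)⁻¹ • (LamInv G (sigma δ f₁ f₂ u s) ∘L Ctil G θ R δ f₁ f₂ u s)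


section ComplexAlgebra

theorem hasDerivAt_sum_ofReal_smul_const {ι F : Type*} [NormedAddCommGroup F] [NormedSpace ℂ F]
    {s : Finset ι} {c : ℝ → ι → ℝ} {c' : ι → ℝ} {t : ℝ} (x : ι → F)
    (h : ∀ i ∈ s, HasDerivAt (fun t => c t i) (c' i) t) :
    HasDerivAt (fun t => ∑ i ∈ s, (c t i : ℂ) • x i) (∑ i ∈ s, (c' i : ℂ) • x i) t :=
  HasDerivAt.fun_sum fun i hi => (h i hi).ofReal_comp.smul_const (x i)

variable {𝔄 : Type*}

/-- `Π⁺` and `Π⁻` annihilate each other as soon as `(LV)² = 1`. -/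
theorem proj_mul_proj [Ring 𝔄] [Algebra ℂ 𝔄] {P : 𝔄} (hP : P * P = 1) :
    ((2 : ℂ)⁻¹ • (1 + P)) * ((2 : ℂ)⁻¹ • (1 - P)) = 0 ∧
      ((2 : ℂ)⁻¹ • (1 - P)) * ((2 : ℂ)⁻¹ • (1 + P)) = 0 := by
  have h1 : (1 + P) * (1 - P) = 1 - P * P := by noncomm_ring
  have h2 : (1 - P) * (1 + P) = 1 - P * P := by noncomm_ring
  simp only [smul_mul_smul_comm, h1, h2, hP, sub_self, smul_zero, and_self]

theorem proj_mul_offDiag_mul_proj [Ring 𝔄] [Algebra ℂ 𝔄] {L P X : 𝔄} (hP : P * P = 1)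
    (hLP : Commute L P) :
    ((2 : ℂ)⁻¹ • (1 + P)) * (L * (((2 : ℂ)⁻¹ • (1 - P)) * (X * ((2 : ℂ)⁻¹ • (1 + P))))
        * ((2 : ℂ)⁻¹ • (1 + P))) = 0 ∧
      ((2 : ℂ)⁻¹ • (1 - P)) * (L * (((2 : ℂ)⁻¹ • (1 - P)) * (X * ((2 : ℂ)⁻¹ • (1 + P))))
        * ((2 : ℂ)⁻¹ • (1 - P))) = 0 := by
  obtain ⟨h1, h2⟩ := proj_mul_proj hP
  have hL : Commute L ((2 : ℂ)⁻¹ • (1 + P)) :=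
    ((Commute.one_right L).add_right hLP).smul_right _
  constructor
  · rw [← mul_assoc, ← mul_assoc, ← hL.eq, mul_assoc L, ← mul_assoc _ _ (X * _), h1]
    simp
  · simp only [mul_assoc, h1, mul_zero]

theorem offDiag_sub_offDiag [Ring 𝔄] [Algebra ℂ 𝔄] {L V K T J : 𝔄} {c : ℂ}
    (hV : V = c • J + K) (hJK : J * K = -(K * J)) (hLV : Commute L V) (hLK : Commute L K)
    (hLT : Commute L T) (hTV : Commute T V) (hTK : Commute T K) :
    (2 : ℂ)⁻¹ • (L * (((2 : ℂ)⁻¹ • (1 - L * V)) * (K * (T * ((2 : ℂ)⁻¹ • (1 + L * V)))))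
        - ((2 : ℂ)⁻¹ • (1 + L * V)) * T * K * ((2 : ℂ)⁻¹ • (1 - L * V)) * L)
      = (c / 2) • (L * (L * (T * (K * J)))) := by
  have hKV : K * V - V * K = (2 * c) • (K * J) := by
    rw [hV, mul_add, add_mul, mul_smul_comm, smul_mul_assoc, hJK]
    module
  have hTP : Commute T (L * V) := hLT.symm.mul_right hTV
  have hLP : Commute L (L * V) := (Commute.refl L).mul_right hLV
  have e1 : L * ((1 - L * V) * (K * (T * (1 + L * V))))
      = L * T * ((1 - L * V) * K * (1 + L * V)) := by
    have : Commute T ((1 - L * V) * K) := ((Commute.one_right T).sub_right hTP).mul_right hTK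
    rw [mul_assoc L T, ← mul_assoc T, this.eq]
    simp only [mul_assoc]
  have e2 : (1 + L * V) * T * K * (1 - L * V) * L
      = L * T * ((1 + L * V) * K * (1 - L * V)) := by
    have h1 : Commute (L * T) (1 + L * V) :=
      (Commute.one_right _).add_right (hLP.mul_left hTP)
    have h2 : Commute L (K * (1 - L * V)) :=
      hLK.mul_right ((Commute.one_right L).sub_right hLP)
    rw [← mul_assoc (L * T), ← mul_assoc (L * T), h1.eq, hLT.eq]
    simp only [mul_assoc]
    rw [← h2.eq.trans (mul_assoc _ _ _)]
  have e3 : (1 - L * V) * K * (1 + L * V) - (1 + L * V) * K * (1 - L * V)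
      = (2 : ℂ) • (L * (K * V - V * K)) := by
    rw [show L * (K * V - V * K) = K * (L * V) - L * V * K by
      rw [mul_sub, ← mul_assoc L K V, hLK.eq, mul_assoc, mul_assoc], two_smul]
    noncomm_ring
  simp only [smul_mul_assoc, mul_smul_comm, ← smul_sub, smul_smul]
  rw [e1, e2, ← mul_sub, e3, hKV]
  simp only [mul_smul_comm, smul_smul]
  have e4 : L * T * (L * (K * J)) = L * (L * (T * (K * J))) := by
    rw [← mul_assoc (L * T), mul_assoc L T, ← hLT.eq]
    simp only [mul_assoc]
  rw [e4]
  congr 1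
  ring

theorem isSelfAdjoint_half_smul [Ring 𝔄] [StarRing 𝔄] [Algebra ℂ 𝔄] [StarModule ℂ 𝔄] {P : 𝔄}
    (hP : IsSelfAdjoint P) :
    IsSelfAdjoint ((2 : ℂ)⁻¹ • (1 + P)) ∧ IsSelfAdjoint ((2 : ℂ)⁻¹ • (1 - P)) := by
  have h : IsSelfAdjoint (2 : ℂ)⁻¹ := (IsSelfAdjoint.ofNat 2).inv₀
  exact ⟨h.smul ((IsSelfAdjoint.one 𝔄).add hP), h.smul ((IsSelfAdjoint.one 𝔄).sub hP)⟩

theorem hasDerivAt_offDiag [NormedRing 𝔄] [NormedAlgebra ℂ 𝔄] {L V : ℝ → 𝔄} {L' J : 𝔄}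
    {t : ℝ} (X : 𝔄) (hL : HasDerivAt L L' t) (hV : HasDerivAt V J t) :
    HasDerivAt (fun t => (2 : ℂ)⁻¹ • (L t * (L t * (((2 : ℂ)⁻¹ • (1 - L t * V t)) *
        (X * ((2 : ℂ)⁻¹ • (1 + L t * V t)))))))
      ((2 : ℂ)⁻¹ • (L' * (L t * (((2 : ℂ)⁻¹ • (1 - L t * V t)) *
          (X * ((2 : ℂ)⁻¹ • (1 + L t * V t))))) +
        L t * (L' * (((2 : ℂ)⁻¹ • (1 - L t * V t)) * (X * ((2 : ℂ)⁻¹ • (1 + L t * V t)))) +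
          L t * (((2 : ℂ)⁻¹ • -(L' * V t + L t * J)) * (X * ((2 : ℂ)⁻¹ • (1 + L t * V t))) +
            ((2 : ℂ)⁻¹ • (1 - L t * V t)) * (X * ((2 : ℂ)⁻¹ • (L' * V t + L t * J))))))) t := by
  have hP := hL.mul hV
  have h1 := (hP.const_sub 1).const_smul (2 : ℂ)⁻¹
  have h2 := ((hP.const_add 1).const_smul (2 : ℂ)⁻¹).const_mul X
  exact (hL.mul (hL.mul (h1.mul h2))).const_smul (2 : ℂ)⁻¹

end ComplexAlgebra

section DiagonalOperators

variable {X : Type*} [NormedAddCommGroup X] [InnerProductSpace ℂ X]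

/-- The block-diagonal operator `diag(a, b)` on `𝓗²`. -/
def diagOp (a b : X →L[ℂ] X) : WithLp 2 (X × X) →L[ℂ] WithLp 2 (X × X) :=
  (eqv (H := X)).symm.toContinuousLinearMap ∘L (a.prodMap b) ∘L
    (eqv (H := X)).toContinuousLinearMap

theorem ext_prod {A B : WithLp 2 (X × X) →L[ℂ] WithLp 2 (X × X)}
    (h : ∀ x, (A x).fst = (B x).fst ∧ (A x).snd = (B x).snd) : A = B := by
  refine ContinuousLinearMap.ext fun x => WithLp.ofLp_injective 2 ?_
  exact Prod.ext (h x).1 (h x).2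

@[simp] theorem diagOp_apply_fst (a b : X →L[ℂ] X) (w : WithLp 2 (X × X)) :
    (diagOp a b w).fst = a w.fst := rfl

@[simp] theorem diagOp_apply_snd (a b : X →L[ℂ] X) (w : WithLp 2 (X × X)) :
    (diagOp a b w).snd = b w.snd := rfl

theorem diagOp_mul (a b c d : X →L[ℂ] X) :
    diagOp a b * diagOp c d = diagOp (a * c) (b * d) := rfl

theorem diagOp_one : diagOp (1 : X →L[ℂ] X) 1 = 1 := rfl

theorem norm_diagOp_le {a b : X →L[ℂ] X} {c : ℝ} (hc : 0 ≤ c) (ha : ‖a‖ ≤ c) (hb : ‖b‖ ≤ c) :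
    ‖diagOp a b‖ ≤ c := by
  refine ContinuousLinearMap.opNorm_le_bound _ hc fun w => ?_
  have h1 : ‖a w.fst‖ ≤ c * ‖w.fst‖ := a.le_of_opNorm_le ha _
  have h2 : ‖b w.snd‖ ≤ c * ‖w.snd‖ := b.le_of_opNorm_le hb _
  refine le_of_sq_le_sq ?_ (by positivity)
  rw [mul_pow, WithLp.prod_norm_sq_eq_of_L2, WithLp.prod_norm_sq_eq_of_L2, diagOp_apply_fst,
    diagOp_apply_snd, mul_add, ← mul_pow, ← mul_pow]
  gcongr

theorem norm_diagOp_one_neg_one_le : ‖diagOp (1 : X →L[ℂ] X) (-1)‖ ≤ 1 :=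
  norm_diagOp_le zero_le_one ContinuousLinearMap.norm_id_le
    ((norm_neg _).trans_le ContinuousLinearMap.norm_id_le)

end DiagonalOperators

section OperatorAlgebra

variable {K : Type*} [NormedAddCommGroup K] [InnerProductSpace ℂ K] [FiniteDimensional ℂ K]

/-- The diagonal functional calculus `diag(f(GG*), f(G*G))`. -/
def specOp (G : H →L[ℂ] H) (f : ℝ → ℝ) : WithLp 2 (H × H) →L[ℂ] WithLp 2 (H × H) :=
  diagOp (cfc f (G * adjoint G)) (cfc f (adjoint G * G))

theorem LamInv_eq_specOp (G : H →L[ℂ] H) (t : ℝ) :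
    LamInv G t = specOp G (fun x => (Real.sqrt (t ^ 2 + x))⁻¹) := rfl

@[simp] theorem Vop_apply_fst (G : H →L[ℂ] H) (s : ℝ) (w : WithLp 2 (H × H)) :
    (Vop G s w).fst = (s : ℂ) • w.fst + G w.snd := rfl

@[simp] theorem Vop_apply_snd (G : H →L[ℂ] H) (s : ℝ) (w : WithLp 2 (H × H)) :
    (Vop G s w).snd = adjoint G w.fst - (s : ℂ) • w.snd := rfl

@[simp] theorem Kcal_apply_fst (G : H →L[ℂ] H) (w : WithLp 2 (H × H)) :
    (Kcal G w).fst = -G w.snd := rfl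

@[simp] theorem Kcal_apply_snd (G : H →L[ℂ] H) (w : WithLp 2 (H × H)) :
    (Kcal G w).snd = adjoint G w.fst := rfl

theorem isSelfAdjoint_diagOp {a b : H →L[ℂ] H} (ha : IsSelfAdjoint a) (hb : IsSelfAdjoint b) :
    IsSelfAdjoint (diagOp a b) := by
  refine ((ContinuousLinearMap.eq_adjoint_iff _ _).2 fun x y => ?_).symm
  rw [WithLp.prod_inner_apply, WithLp.prod_inner_apply]
  exact congrArg₂ _ (ha.isSymmetric _ _) (hb.isSymmetric _ _)

theorem isSelfAdjoint_Vop (G : H →L[ℂ] H) (t : ℝ) : IsSelfAdjoint (Vop G t) := by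
  refine ((ContinuousLinearMap.eq_adjoint_iff _ _).2 fun x y => ?_).symm
  rw [WithLp.prod_inner_apply, WithLp.prod_inner_apply]
  change ⟪(t : ℂ) • x.fst + G x.snd, y.fst⟫_ℂ + ⟪adjoint G x.fst - (t : ℂ) • x.snd, y.snd⟫_ℂ
    = ⟪x.fst, (t : ℂ) • y.fst + G y.snd⟫_ℂ + ⟪x.snd, adjoint G y.fst - (t : ℂ) • y.snd⟫_ℂ
  simp only [inner_add_left, inner_sub_left, inner_add_right, inner_sub_right, inner_smul_left,
    inner_smul_right, ContinuousLinearMap.adjoint_inner_left,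
    ContinuousLinearMap.adjoint_inner_right, Complex.conj_ofReal]
  ring

theorem finite_real_spectrum (A : K →L[ℂ] K) : (spectrum ℝ A).Finite := by
  have h : (spectrum ℂ A).Finite := by
    rw [← AlgEquiv.spectrum_eq (Module.End.toContinuousLinearMap K).symm A]
    exact Module.End.finite_spectrum _
  refine (h.preimage Complex.ofReal_injective.injOn).subset fun x hx => ?_
  exact (spectrum.algebraMap_mem_iff ℂ).2 hx

theorem spectrum_pos {A : K →L[ℂ] K} (hA : IsUnit A) (hA' : 0 ≤ A) {x : ℝ}
    (hx : x ∈ spectrum ℝ A) : 0 < x :=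
  lt_of_le_of_ne (spectrum_nonneg_of_nonneg hA' hx) fun h =>
    spectrum.zero_notMem ℝ hA (h ▸ hx)

theorem isSelfAdjoint_mul_adjoint (G : H →L[ℂ] H) : IsSelfAdjoint (G * adjoint G) :=
  IsSelfAdjoint.mul_star_self G

theorem isSelfAdjoint_adjoint_mul (G : H →L[ℂ] H) : IsSelfAdjoint (adjoint G * G) :=
  IsSelfAdjoint.star_mul_self G

/-- The union of the spectra of `GG*` and `G*G`. -/
def jointSpec (G : K →L[ℂ] K) : Finset ℝ :=
  ((finite_real_spectrum (G * adjoint G)).union (finite_real_spectrum (adjoint G * G))).toFinset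

theorem mem_jointSpec {G : K →L[ℂ] K} {x : ℝ} :
    x ∈ jointSpec G ↔ x ∈ spectrum ℝ (G * adjoint G) ∨ x ∈ spectrum ℝ (adjoint G * G) := by
  simp [jointSpec]

theorem jointSpec_pos {G : K →L[ℂ] K} (hG : IsUnit G) {x : ℝ} (hx : x ∈ jointSpec G) : 0 < x := by
  have hG' : IsUnit (adjoint G) := hG.star
  rcases mem_jointSpec.1 hx with h | h
  · exact spectrum_pos (hG.mul hG') (mul_star_self_nonneg G) h
  · exact spectrum_pos (hG'.mul hG) (star_mul_self_nonneg G) h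

theorem continuousOn_real_spectrum (A : K →L[ℂ] K) (f : ℝ → ℝ) : ContinuousOn f (spectrum ℝ A) :=
  (finite_real_spectrum A).continuousOn f

theorem specOp_congr {G : K →L[ℂ] K} {f g : ℝ → ℝ} (h : ∀ x ∈ jointSpec G, f x = g x) :
    specOp G f = specOp G g := by
  unfold specOp
  rw [cfc_congr fun x hx => h x (mem_jointSpec.2 (Or.inl hx)),
    cfc_congr fun x hx => h x (mem_jointSpec.2 (Or.inr hx))]

theorem specOp_mul (G : K →L[ℂ] K) (f g : ℝ → ℝ) :
    specOp G f * specOp G g = specOp G (fun x => f x * g x) := by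
  unfold specOp
  rw [diagOp_mul, cfc_mul f g _ (continuousOn_real_spectrum _ _) (continuousOn_real_spectrum _ _),
    cfc_mul f g _ (continuousOn_real_spectrum _ _) (continuousOn_real_spectrum _ _)]

theorem specOp_one (G : K →L[ℂ] K) : specOp G (fun _ => 1) = 1 := by
  unfold specOp
  rw [cfc_const_one ℝ _ (isSelfAdjoint_mul_adjoint G),
    cfc_const_one ℝ _ (isSelfAdjoint_adjoint_mul G), diagOp_one]

theorem commute_specOp (G : K →L[ℂ] K) (f g : ℝ → ℝ) : Commute (specOp G f) (specOp G g) := by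
  rw [Commute, SemiconjBy, specOp_mul, specOp_mul]
  simp only [mul_comm]

theorem isSelfAdjoint_specOp (G : K →L[ℂ] K) (f : ℝ → ℝ) : IsSelfAdjoint (specOp G f) :=
  isSelfAdjoint_diagOp (cfc_predicate f _) (cfc_predicate f _)

theorem norm_specOp_le {G : K →L[ℂ] K} {f : ℝ → ℝ} {c : ℝ} (hc : 0 ≤ c)
    (h : ∀ x ∈ jointSpec G, |f x| ≤ c) : ‖specOp G f‖ ≤ c :=
  norm_diagOp_le hc (norm_cfc_le hc fun x hx => h x (mem_jointSpec.2 (Or.inl hx)))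
    (norm_cfc_le hc fun x hx => h x (mem_jointSpec.2 (Or.inr hx)))

theorem specOp_add (G : K →L[ℂ] K) (f g : ℝ → ℝ) :
    specOp G f + specOp G g = specOp G (fun x => f x + g x) := by
  unfold specOp
  rw [cfc_add _ f g (continuousOn_real_spectrum _ _) (continuousOn_real_spectrum _ _),
    cfc_add _ f g (continuousOn_real_spectrum _ _) (continuousOn_real_spectrum _ _)]
  rfl

theorem specOp_smul (G : K →L[ℂ] K) (c : ℝ) (f : ℝ → ℝ) :
    (c : ℂ) • specOp G f = specOp G (fun x => c * f x) := by
  unfold specOp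
  rw [cfc_const_mul c f _ (continuousOn_real_spectrum _ _),
    cfc_const_mul c f _ (continuousOn_real_spectrum _ _)]
  rfl

theorem specOp_eq_sum (G : K →L[ℂ] K) (f : ℝ → ℝ) :
    specOp G f = ∑ l ∈ jointSpec G, (f l : ℂ) • specOp G (Pi.single l 1) := by
  have key (s : Finset ℝ) (g : ℝ → ℝ → ℝ) :
      ∑ l ∈ s, specOp G (g l) = specOp G (fun x => ∑ l ∈ s, g l x) := by
    induction s using Finset.induction_on with
    | empty =>
      rw [Finset.sum_empty]
      simp only [Finset.sum_empty, specOp, cfc_const_zero]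
      rfl
    | insert a s ha ih => simp only [Finset.sum_insert ha, ih, specOp_add]
  simp only [specOp_smul, key]
  refine specOp_congr fun x hx => ?_
  simp only [Pi.single_apply, mul_ite, mul_one, mul_zero]
  simp [hx]

theorem hasDerivAt_specOp {G : K →L[ℂ] K} {f : ℝ → ℝ → ℝ} {f' : ℝ → ℝ} {t : ℝ}
    (h : ∀ x ∈ jointSpec G, HasDerivAt (fun t => f t x) (f' x) t) :
    HasDerivAt (fun t => specOp G (f t)) (specOp G f') t := by
  simp only [specOp_eq_sum G (f _), specOp_eq_sum G f']
  exact hasDerivAt_sum_ofReal_smul_const (F := WithLp 2 (K × K) →L[ℂ] WithLp 2 (K × K)) _ h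

theorem fc_ofReal (f : ℝ → ℝ) (A : K →L[ℂ] K) : fc (fun x => (f x : ℂ)) A = cfc f A := by
  simp only [fc, Complex.ofReal_re, Complex.ofReal_im]
  rw [cfc_const_zero, smul_zero, add_zero]

theorem exists_continuous_eqOn (s : Finset ℝ) (f : ℝ → ℝ) :
    ∃ g : ℝ → ℝ, Continuous g ∧ ∀ x ∈ s, g x = f x :=
  ⟨fun x => (Lagrange.interpolate s id f).eval x, Polynomial.continuous _, fun _ hx =>
    Lagrange.eval_interpolate_at_node f Function.injective_id.injOn hx⟩

theorem commute_specOp_Vop_zero {G : K →L[ℂ] K} (hG : CommHyp G) (f : ℝ → ℝ) :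
    Commute (specOp G f) (Vop G 0) := by
  obtain ⟨g, hg, hfg⟩ := exists_continuous_eqOn (jointSpec G) f
  rw [← specOp_congr hfg]
  obtain ⟨h1, h2⟩ := hG (fun x => (g x : ℂ)) (by fun_prop)
  rw [fc_ofReal, fc_ofReal] at h1 h2
  refine ext_prod fun w => ⟨?_, ?_⟩
  · simpa [specOp] using congrArg (· w.snd) h1
  · simpa [specOp] using congrArg (· w.fst) h2

theorem commute_specOp_diagOp (G : K →L[ℂ] K) (f : ℝ → ℝ) :
    Commute (specOp G f) (diagOp 1 (-1)) := by
  refine ext_prod fun w => ⟨?_, ?_⟩ <;> simp [specOp]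

theorem Vop_eq (G : K →L[ℂ] K) (t : ℝ) : Vop G t = (t : ℂ) • diagOp 1 (-1) + Vop G 0 := by
  refine ext_prod fun w => ⟨?_, ?_⟩
  · simp
  · simp only [Vop_apply_snd, add_apply, WithLp.add_snd]
    simp [sub_eq_neg_add]

theorem commute_specOp_Vop {G : K →L[ℂ] K} (hG : CommHyp G) (f : ℝ → ℝ) (t : ℝ) :
    Commute (specOp G f) (Vop G t) := by
  rw [Vop_eq G t]
  exact ((commute_specOp_diagOp G f).smul_right (t : ℂ)).add_right (commute_specOp_Vop_zero hG f)

theorem Vop_mul_self (G : K →L[ℂ] K) (t : ℝ) :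
    Vop G t * Vop G t = specOp G (fun x => t ^ 2 + x) := by
  rw [← specOp_add G (fun _ => t ^ 2) (fun x => x), ← mul_one (t ^ 2),
    ← specOp_smul G (t ^ 2) (fun _ => 1), specOp_one]
  have h1 : cfc (fun x : ℝ => x) (G * adjoint G) = G * adjoint G :=
    cfc_id' ℝ _ (isSelfAdjoint_mul_adjoint G)
  have h2 : cfc (fun x : ℝ => x) (adjoint G * G) = adjoint G * G :=
    cfc_id' ℝ _ (isSelfAdjoint_adjoint_mul G)
  rw [specOp, h1, h2]
  refine ext_prod fun w => ⟨?_, ?_⟩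
  · simp [pow_two, mul_smul]
  · simp [pow_two, mul_smul, smul_sub, -Complex.coe_smul]
    abel

theorem LamInv_mul_self_mul_Vop_mul_self {G : K →L[ℂ] K} (hG : IsUnit G) (t : ℝ) :
    LamInv G t * LamInv G t * (Vop G t * Vop G t) = 1 := by
  rw [LamInv_eq_specOp, Vop_mul_self, specOp_mul, specOp_mul, ← specOp_one G]
  refine specOp_congr fun x hx => ?_
  have hx := jointSpec_pos hG hx
  have h : 0 < t ^ 2 + x := by positivity
  rw [← mul_inv, Real.mul_self_sqrt h.le, inv_mul_cancel₀ h.ne']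

end OperatorAlgebra

section Resolvent

variable {K : Type*} [NormedAddCommGroup K] [InnerProductSpace ℂ K] [FiniteDimensional ℂ K]
  {G : K →L[ℂ] K}

theorem isSelfAdjoint_LamInv (G : K →L[ℂ] K) (t : ℝ) : IsSelfAdjoint (LamInv G t) :=
  isSelfAdjoint_specOp G _

theorem commute_LamInv_Vop (hG : CommHyp G) (t r : ℝ) : Commute (LamInv G t) (Vop G r) :=
  commute_specOp_Vop hG _ r

theorem LamInv_mul_Vop_mul_self (hG : CommHyp G) (hGu : IsUnit G) (t : ℝ) :
    LamInv G t * Vop G t * (LamInv G t * Vop G t) = 1 := by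
  rw [(commute_LamInv_Vop hG t t).symm.mul_mul_mul_comm, LamInv_mul_self_mul_Vop_mul_self hGu]

theorem isSelfAdjoint_LamInv_mul_Vop (hG : CommHyp G) (t : ℝ) :
    IsSelfAdjoint (LamInv G t * Vop G t) :=
  ((isSelfAdjoint_LamInv G t).commute_iff (isSelfAdjoint_Vop G t)).1 (commute_LamInv_Vop hG t t)

theorem norm_LamInv_mul_Vop_le (hG : CommHyp G) (hGu : IsUnit G) (t : ℝ) :
    ‖LamInv G t * Vop G t‖ ≤ 1 := by
  have h := CStarRing.norm_star_mul_self (x := LamInv G t * Vop G t)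
  rw [(isSelfAdjoint_LamInv_mul_Vop hG t).star_eq, LamInv_mul_Vop_mul_self hG hGu] at h
  have h1 : ‖(1 : WithLp 2 (K × K) →L[ℂ] WithLp 2 (K × K))‖ ≤ 1 := ContinuousLinearMap.norm_id_le
  nlinarith [norm_nonneg (LamInv G t * Vop G t)]

theorem norm_PiP_le (hG : CommHyp G) (hGu : IsUnit G) (t : ℝ) : ‖PiP G t‖ ≤ 1 := by
  have h1 : ‖(1 : WithLp 2 (K × K) →L[ℂ] WithLp 2 (K × K))‖ ≤ 1 := ContinuousLinearMap.norm_id_le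
  have h := norm_add_le_of_le h1 (norm_LamInv_mul_Vop_le hG hGu t)
  change ‖(2 : ℂ)⁻¹ • (1 + LamInv G t * Vop G t)‖ ≤ 1
  rw [norm_smul, norm_inv, Complex.norm_ofNat]
  linarith

theorem norm_PiM_le (hG : CommHyp G) (hGu : IsUnit G) (t : ℝ) : ‖PiM G t‖ ≤ 1 := by
  have h1 : ‖(1 : WithLp 2 (K × K) →L[ℂ] WithLp 2 (K × K))‖ ≤ 1 := ContinuousLinearMap.norm_id_le
  have h := norm_sub_le_of_le h1 (norm_LamInv_mul_Vop_le hG hGu t)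
  change ‖(2 : ℂ)⁻¹ • (1 - LamInv G t * Vop G t)‖ ≤ 1
  rw [norm_smul, norm_inv, Complex.norm_ofNat]
  linarith

theorem Vop_zero_mul_diagOp (G : K →L[ℂ] K) : Vop G 0 * diagOp 1 (-1) = Kcal G := by
  refine ext_prod fun w => ⟨?_, ?_⟩ <;> simp

theorem diagOp_mul_Vop_zero (G : K →L[ℂ] K) :
    diagOp 1 (-1) * Vop G 0 = -(Vop G 0 * diagOp 1 (-1)) := by
  refine ext_prod fun w => ⟨?_, ?_⟩ <;> simp

theorem exists_pos_le_jointSpec (hGu : IsUnit G) : ∃ c > 0, ∀ x ∈ jointSpec G, c ≤ x := by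
  have h : ∀ᶠ c in 𝓝[>] (0 : ℝ), ∀ x ∈ jointSpec G, c ≤ x :=
    (Filter.eventually_all_finset _).2 fun x hx =>
      nhdsWithin_le_nhds (eventually_le_nhds (jointSpec_pos hGu hx))
  obtain ⟨c, hc, hc'⟩ := (h.and self_mem_nhdsWithin).exists
  exact ⟨c, hc', hc⟩

theorem inv_sqrt_le_inv_sqrt {c x : ℝ} (hc : 0 < c) (hx : c ≤ x) (t : ℝ) :
    (√(t ^ 2 + x))⁻¹ ≤ (√(t ^ 2 + c))⁻¹ := by
  gcongr

theorem abs_mul_inv_sqrt_le_one {x : ℝ} (hx : 0 < x) (t : ℝ) : |t| * (√(t ^ 2 + x))⁻¹ ≤ 1 := by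
  rw [← div_eq_mul_inv]
  exact div_le_one_of_le₀ (Real.abs_le_sqrt (by linarith)) (Real.sqrt_nonneg _)

theorem norm_LamInv_le {c : ℝ} (hc : 0 < c) (h : ∀ x ∈ jointSpec G, c ≤ x) (t : ℝ) :
    ‖LamInv G t‖ ≤ (√(t ^ 2 + c))⁻¹ :=
  norm_specOp_le (by positivity) fun x hx => by
    rw [abs_of_nonneg (by positivity)]
    exact inv_sqrt_le_inv_sqrt hc (h x hx) t

/-- The derivative of `t ↦ Λ_t⁻¹`, namely `-tΛ_t⁻³`. -/
def derivLamInv (G : K →L[ℂ] K) (t : ℝ) : WithLp 2 (K × K) →L[ℂ] WithLp 2 (K × K) :=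
  specOp G (fun x => -t * (√(t ^ 2 + x))⁻¹ ^ 3)

theorem hasDerivAt_LamInv (hGu : IsUnit G) (t : ℝ) :
    HasDerivAt (LamInv G) (derivLamInv G t) t := by
  refine hasDerivAt_specOp fun x hx => ?_
  have hx := jointSpec_pos hGu hx
  have h : 0 < t ^ 2 + x := by positivity
  have h' : 0 < √(t ^ 2 + x) := Real.sqrt_pos.2 h
  refine ((((hasDerivAt_pow 2 t).add_const x).sqrt h.ne').inv h'.ne').congr_deriv ?_
  field_simp
  norm_num

theorem hasDerivAt_Vop (G : K →L[ℂ] K) (t : ℝ) : HasDerivAt (Vop G) (diagOp 1 (-1)) t := by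
  have h := (hasDerivAt_sum_ofReal_smul_const (s := {()}) (c := fun t _ => t) (t := t)
    (F := WithLp 2 (K × K) →L[ℂ] WithLp 2 (K × K)) (fun _ => diagOp 1 (-1))
    fun _ _ => hasDerivAt_id t).add_const (Vop G 0)
  refine (h.congr_deriv ?_).congr_of_eventuallyEq (.of_forall fun r => ?_)
  · rw [Finset.sum_singleton, Complex.ofReal_one, one_smul]
  · rw [Vop_eq G r]
    simp only [Finset.sum_singleton]

theorem norm_derivLamInv_le {c : ℝ} (hc : 0 < c) (h : ∀ x ∈ jointSpec G, c ≤ x) (t : ℝ) :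
    ‖derivLamInv G t‖ ≤ (√(t ^ 2 + c))⁻¹ ^ 2 := by
  refine norm_specOp_le (by positivity) fun x hx => ?_
  have h1 := inv_sqrt_le_inv_sqrt hc (h x hx) t
  have h2 := abs_mul_inv_sqrt_le_one (hc.trans_le (h x hx)) t
  have h0 : 0 ≤ (√(t ^ 2 + x))⁻¹ := by positivity
  rw [abs_mul, abs_neg, abs_of_nonneg (pow_nonneg h0 3)]
  calc |t| * (√(t ^ 2 + x))⁻¹ ^ 3 = |t| * (√(t ^ 2 + x))⁻¹ * (√(t ^ 2 + x))⁻¹ ^ 2 := by ring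
    _ ≤ 1 * (√(t ^ 2 + c))⁻¹ ^ 2 := by gcongr
    _ = _ := one_mul _

theorem norm_derivLamInv_mul_Vop_le (hG : CommHyp G) (hGu : IsUnit G) {c : ℝ} (hc : 0 < c)
    (h : ∀ x ∈ jointSpec G, c ≤ x) (t : ℝ) :
    ‖derivLamInv G t * Vop G t + LamInv G t * diagOp 1 (-1)‖ ≤ 2 * (√(t ^ 2 + c))⁻¹ := by
  have e : derivLamInv G t = specOp G (fun x => -t * (√(t ^ 2 + x))⁻¹ ^ 2) * LamInv G t := by
    rw [LamInv_eq_specOp, specOp_mul]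
    exact specOp_congr fun x _ => by ring
  have h1 : ‖specOp G (fun x => -t * (√(t ^ 2 + x))⁻¹ ^ 2)‖ ≤ (√(t ^ 2 + c))⁻¹ := by
    refine norm_specOp_le (by positivity) fun x hx => ?_
    have h1 := inv_sqrt_le_inv_sqrt hc (h x hx) t
    have h2 := abs_mul_inv_sqrt_le_one (hc.trans_le (h x hx)) t
    have h0 : 0 ≤ (√(t ^ 2 + x))⁻¹ := by positivity
    rw [abs_mul, abs_neg, abs_of_nonneg (pow_nonneg h0 2)]
    calc |t| * (√(t ^ 2 + x))⁻¹ ^ 2 = |t| * (√(t ^ 2 + x))⁻¹ * (√(t ^ 2 + x))⁻¹ := by ring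
      _ ≤ 1 * (√(t ^ 2 + c))⁻¹ := by gcongr
      _ = _ := one_mul _
  rw [e, mul_assoc]
  have h0 : 0 ≤ (√(t ^ 2 + c))⁻¹ := by positivity
  have h2 := norm_mul_le_of_le h1 (norm_LamInv_mul_Vop_le hG hGu t)
  have h3 := norm_mul_le_of_le (norm_LamInv_le hc h t) (norm_diagOp_one_neg_one_le (X := K))
  have h4 := norm_add_le_of_le h2 h3
  linarith

end Resolvent

section Trajectory

variable {K : Type*} [NormedAddCommGroup K] [InnerProductSpace ℂ K] [FiniteDimensional ℂ K]
  {G : K →L[ℂ] K} {δ : ℝ} {f₁ f₂ : ℝ × ℝ → ℝ} {u : ℝ → WithLp 2 (K × K)}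

theorem hasDerivAt_norm_fst_sq (h : IsLZSol G δ f₁ f₂ u) (s : ℝ) :
    HasDerivAt (fun r => ‖(u r).fst‖ ^ 2) (-2 * (⟪(u s).fst, G (u s).snd⟫_ℂ).im) s := by
  have h1 : HasDerivAt (fun r => (u r).fst)
      (Complex.I • ((s : ℂ) • (u s).fst + G (u s).snd + δ • F1 f₁ (u s) • (u s).fst)) s :=
    ((ContinuousLinearMap.fst ℂ K K ∘L
      (eqv (H := K)).toContinuousLinearMap).restrictScalars ℝ).hasFDerivAt.comp_hasDerivAt s (h s)
  let : InnerProductSpace ℝ K := InnerProductSpace.rclikeToReal ℂ K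
  refine h1.norm_sq.congr_deriv ?_
  rw [real_inner_eq_re_inner ℂ]
  simp only [inner_add_right, inner_smul_right, RCLike.real_smul_eq_coe_smul (K := ℂ),
    inner_self_eq_norm_sq_to_K]
  simp [← Complex.ofReal_pow]

theorem hasDerivAt_norm_snd_sq (h : IsLZSol G δ f₁ f₂ u) (s : ℝ) :
    HasDerivAt (fun r => ‖(u r).snd‖ ^ 2) (2 * (⟪(u s).fst, G (u s).snd⟫_ℂ).im) s := by
  have h1 : HasDerivAt (fun r => (u r).snd)
      (Complex.I • (adjoint G (u s).fst - (s : ℂ) • (u s).snd + δ • F2 f₂ (u s) • (u s).snd)) s :=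
    ((ContinuousLinearMap.snd ℂ K K ∘L
      (eqv (H := K)).toContinuousLinearMap).restrictScalars ℝ).hasFDerivAt.comp_hasDerivAt s (h s)
  let : InnerProductSpace ℝ K := InnerProductSpace.rclikeToReal ℂ K
  refine h1.norm_sq.congr_deriv ?_
  rw [real_inner_eq_re_inner ℂ]
  simp only [inner_add_right, inner_sub_right, inner_smul_right,
    RCLike.real_smul_eq_coe_smul (K := ℂ), inner_self_eq_norm_sq_to_K,
    ContinuousLinearMap.adjoint_inner_right]
  simp [← Complex.ofReal_pow]
  rw [← inner_conj_symm (u s).fst, Complex.conj_im, mul_neg]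

theorem norm_sq_add_norm_sq_eq (h : IsLZSol G δ f₁ f₂ u) (s : ℝ) :
    ‖(u s).fst‖ ^ 2 + ‖(u s).snd‖ ^ 2 = ‖(u 0).fst‖ ^ 2 + ‖(u 0).snd‖ ^ 2 := by
  have h' (r : ℝ) : HasDerivAt (fun r => ‖(u r).fst‖ ^ 2 + ‖(u r).snd‖ ^ 2) 0 r :=
    ((hasDerivAt_norm_fst_sq h r).add (hasDerivAt_norm_snd_sq h r)).congr_deriv (by ring)
  exact is_const_of_deriv_eq_zero (fun r => (h' r).differentiableAt) (fun r => (h' r).deriv) s 0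

theorem exists_sigma_bound (G : K →L[ℂ] K) (δ : ℝ) (hf₁ : ContDiff ℝ 2 f₁)
    (hf₂ : ContDiff ℝ 2 f₂) :
    ∃ M ≥ 0, ∀ u : ℝ → WithLp 2 (K × K), ‖(u 0).fst‖ ^ 2 + ‖(u 0).snd‖ ^ 2 = 1 →
      IsLZSol G δ f₁ f₂ u → ∀ s, |sigma δ f₁ f₂ u s - s| ≤ M ∧
        ∃ σ', HasDerivAt (sigma δ f₁ f₂ u) σ' s ∧ |σ'| ≤ 1 + M * (2 * ‖G‖) := by
  have hm : ContDiff ℝ 2 (mtilde δ f₁ f₂) := contDiff_const.mul (hf₁.sub hf₂)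
  have hcomp : IsCompact (Set.Icc (0 : ℝ) 1 ×ˢ Set.Icc (0 : ℝ) 1) :=
    isCompact_Icc.prod isCompact_Icc
  obtain ⟨M₁, hM₁⟩ := hcomp.exists_bound_of_continuousOn hm.continuous.continuousOn
  obtain ⟨M₂, hM₂⟩ := hcomp.exists_bound_of_continuousOn
    (hm.continuous_fderiv two_ne_zero).continuousOn
  refine ⟨max 0 (max M₁ M₂), le_max_left _ _, fun u hu h s => ?_⟩
  have hs := (norm_sq_add_norm_sq_eq h s).trans hu
  have h1 : ‖(u s).fst‖ ^ 2 ≤ 1 := by nlinarith [sq_nonneg ‖(u s).snd‖]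
  have h2 : ‖(u s).snd‖ ^ 2 ≤ 1 := by nlinarith [sq_nonneg ‖(u s).fst‖]
  have hmem : (‖(u s).fst‖ ^ 2, ‖(u s).snd‖ ^ 2) ∈ Set.Icc (0 : ℝ) 1 ×ˢ Set.Icc (0 : ℝ) 1 :=
    ⟨⟨by positivity, h1⟩, by positivity, h2⟩
  have hd : |(⟪(u s).fst, G (u s).snd⟫_ℂ).im| ≤ ‖G‖ := by
    have h1 := (sq_le_one_iff₀ (norm_nonneg _)).1 h1
    have h2 := (sq_le_one_iff₀ (norm_nonneg _)).1 h2
    calc _ ≤ ‖⟪(u s).fst, G (u s).snd⟫_ℂ‖ := Complex.abs_im_le_norm _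
      _ ≤ ‖(u s).fst‖ * (‖G‖ * ‖(u s).snd‖) :=
        (norm_inner_le_norm _ _).trans (by gcongr; exact G.le_opNorm _)
      _ ≤ 1 * (‖G‖ * 1) := by gcongr
      _ = _ := by ring
  have hmt := (hm.differentiable two_ne_zero _).hasFDerivAt.comp_hasDerivAt s
    ((hasDerivAt_norm_fst_sq h s).prodMk (hasDerivAt_norm_snd_sq h s))
  refine ⟨?_, _, (hasDerivAt_id s).add hmt, ?_⟩
  · rw [sigma, add_sub_cancel_left]
    exact (hM₁ _ hmem).trans ((le_max_left _ _).trans (le_max_right _ _))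
  · refine (abs_add_le _ _).trans (add_le_add (abs_one (α := ℝ)).le ?_)
    refine ContinuousLinearMap.le_of_opNorm_le_of_le _
      ((hM₂ _ hmem).trans ((le_max_right _ _).trans (le_max_right _ _))) ?_
    rw [Prod.norm_def]
    simp only [Real.norm_eq_abs, abs_mul, abs_neg, abs_two, max_self]
    gcongr

end Trajectory

section OffDiagonal

variable {K : Type*} [NormedAddCommGroup K] [InnerProductSpace ℂ K] [FiniteDimensional ℂ K]
  {G : K →L[ℂ] K}

theorem PiP_mul_Ctil_mul_PiP (hG : CommHyp G) (hGu : IsUnit G) (θ : ℝ → ℝ) (R δ : ℝ)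
    (f₁ f₂ : ℝ × ℝ → ℝ) (u : ℝ → WithLp 2 (K × K)) (s : ℝ) :
    PiP G (sigma δ f₁ f₂ u s) ∘L Ctil G θ R δ f₁ f₂ u s ∘L PiP G (sigma δ f₁ f₂ u s) = 0 ∧
      PiM G (sigma δ f₁ f₂ u s) ∘L Ctil G θ R δ f₁ f₂ u s ∘L PiM G (sigma δ f₁ f₂ u s) = 0 :=
  proj_mul_offDiag_mul_proj (X := Vop G 0 * Theta G θ R)
    (LamInv_mul_Vop_mul_self hG hGu (sigma δ f₁ f₂ u s))
    ((Commute.refl _).mul_right (commute_LamInv_Vop hG _ _))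

theorem Ctil_sub_adjoint (hG : CommHyp G) (θ : ℝ → ℝ) (R δ : ℝ)
    (f₁ f₂ : ℝ × ℝ → ℝ) (u : ℝ → WithLp 2 (K × K)) (s : ℝ) :
    (2 : ℂ)⁻¹ • (Ctil G θ R δ f₁ f₂ u s - adjoint (Ctil G θ R δ f₁ f₂ u s))
      = ((sigma δ f₁ f₂ u s / 2 : ℝ) : ℂ) •
          (LamInv G (sigma δ f₁ f₂ u s) ∘L LamInv G (sigma δ f₁ f₂ u s)
            ∘L Theta G θ R ∘L Kcal G) := by
  have hadj : adjoint (Ctil G θ R δ f₁ f₂ u s) =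
      PiP G (sigma δ f₁ f₂ u s) * Theta G θ R * Vop G 0 * PiM G (sigma δ f₁ f₂ u s) *
        LamInv G (sigma δ f₁ f₂ u s) := by
    generalize hr : sigma δ f₁ f₂ u s = r
    obtain ⟨h1, h2⟩ := isSelfAdjoint_half_smul
      (𝔄 := WithLp 2 (K × K) →L[ℂ] WithLp 2 (K × K)) (isSelfAdjoint_LamInv_mul_Vop hG r)
    have h1 : star (PiP G r) = PiP G r := h1
    have h2 : star (PiM G r) = PiM G r := h2
    have h3 : star (Theta G θ R) = Theta G θ R := (isSelfAdjoint_specOp G _).star_eq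
    have h4 : Ctil G θ R δ f₁ f₂ u s =
        LamInv G r * (PiM G r * (Vop G 0 * (Theta G θ R * PiP G r))) := hr ▸ rfl
    rw [h4, ← star_eq_adjoint]
    simp only [star_mul, h1, h2, h3, (isSelfAdjoint_LamInv G r).star_eq,
      (isSelfAdjoint_Vop G 0).star_eq]
  rw [hadj, ← Vop_zero_mul_diagOp, Complex.ofReal_div, Complex.ofReal_ofNat]
  exact offDiag_sub_offDiag (Vop_eq G _) (diagOp_mul_Vop_zero G) (commute_LamInv_Vop hG _ _)
    (commute_LamInv_Vop hG _ _) (commute_specOp G _ _) (commute_specOp_Vop hG _ _)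
    (commute_specOp_Vop hG _ _)

theorem norm_Ctil_le (hG : CommHyp G) (hGu : IsUnit G) {c : ℝ} (hc : 0 < c)
    (h : ∀ x ∈ jointSpec G, c ≤ x) (θ : ℝ → ℝ) (R δ : ℝ)
    (f₁ f₂ : ℝ × ℝ → ℝ) (u : ℝ → WithLp 2 (K × K)) (s : ℝ) :
    ‖Ctil G θ R δ f₁ f₂ u s‖ ≤
      (√(sigma δ f₁ f₂ u s ^ 2 + c))⁻¹ * ‖Vop G 0 * Theta G θ R‖ := by
  have h1 := norm_mul_le_of_le (norm_LamInv_le hc h (sigma δ f₁ f₂ u s))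
    (norm_mul_le_of_le (norm_PiM_le hG hGu (sigma δ f₁ f₂ u s))
      (norm_mul_le_of_le (le_refl ‖Vop G 0 * Theta G θ R‖)
        (norm_PiP_le hG hGu (sigma δ f₁ f₂ u s))))
  rw [one_mul, mul_one] at h1
  exact h1

theorem norm_Btil_le (hG : CommHyp G) (hGu : IsUnit G) {c : ℝ} (hc : 0 < c)
    (h : ∀ x ∈ jointSpec G, c ≤ x) (θ : ℝ → ℝ) (R δ : ℝ)
    (f₁ f₂ : ℝ × ℝ → ℝ) (u : ℝ → WithLp 2 (K × K)) (s : ℝ) :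
    ‖Btil G θ R δ f₁ f₂ u s‖ ≤
      (√(sigma δ f₁ f₂ u s ^ 2 + c))⁻¹ ^ 2 * ‖Vop G 0 * Theta G θ R‖ := by
  have h1 := norm_mul_le_of_le (norm_LamInv_le hc h (sigma δ f₁ f₂ u s))
    (norm_Ctil_le hG hGu hc h θ R δ f₁ f₂ u s)
  change ‖(2 : ℂ)⁻¹ • (LamInv G (sigma δ f₁ f₂ u s) * Ctil G θ R δ f₁ f₂ u s)‖ ≤ _
  rw [norm_smul, norm_inv, Complex.norm_ofNat]
  linarith [norm_nonneg (LamInv G (sigma δ f₁ f₂ u s) * Ctil G θ R δ f₁ f₂ u s)]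

theorem norm_deriv_Btil_le (hG : CommHyp G) (hGu : IsUnit G) {c : ℝ} (hc : 0 < c)
    (h : ∀ x ∈ jointSpec G, c ≤ x) (θ : ℝ → ℝ) (R δ : ℝ)
    (f₁ f₂ : ℝ × ℝ → ℝ) (u : ℝ → WithLp 2 (K × K)) {s σ' : ℝ}
    (hσ : HasDerivAt (sigma δ f₁ f₂ u) σ' s) :
    ‖deriv (Btil G θ R δ f₁ f₂ u) s‖ ≤
      |σ'| * (2 * (√(sigma δ f₁ f₂ u s ^ 2 + c))⁻¹ ^ 3 * ‖Vop G 0 * Theta G θ R‖) := by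
  have hB := (hasDerivAt_offDiag (Vop G 0 * Theta G θ R)
    (hasDerivAt_LamInv hGu (sigma δ f₁ f₂ u s)) (hasDerivAt_Vop G (sigma δ f₁ f₂ u s))).scomp s hσ
  have hB' : deriv (Btil G θ R δ f₁ f₂ u) s = _ := hB.deriv
  rw [hB', norm_smul, Real.norm_eq_abs]
  refine mul_le_mul_of_nonneg_left ?_ (abs_nonneg _)
  generalize sigma δ f₁ f₂ u s = t
  have hL := norm_LamInv_le hc h t
  have hL' := norm_derivLamInv_le hc h t
  have hP := norm_derivLamInv_mul_Vop_le hG hGu hc h t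
  have hP' : ‖(2 : ℂ)⁻¹ • (derivLamInv G t * Vop G t + LamInv G t * diagOp 1 (-1))‖ ≤
      (√(t ^ 2 + c))⁻¹ := by
    rw [norm_smul, norm_inv, Complex.norm_ofNat]
    linarith
  have hM' : ‖(2 : ℂ)⁻¹ • -(derivLamInv G t * Vop G t + LamInv G t * diagOp 1 (-1))‖ ≤
      (√(t ^ 2 + c))⁻¹ := by
    rwa [smul_neg, norm_neg]
  have hXP := norm_mul_le_of_le (le_refl ‖Vop G 0 * Theta G θ R‖) (norm_PiP_le hG hGu t)
  have hN := norm_mul_le_of_le (norm_PiM_le hG hGu t) hXP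
  have b1 := norm_mul_le_of_le hL' (norm_mul_le_of_le hL hN)
  have b2 := norm_mul_le_of_le hL' hN
  have b3 := norm_mul_le_of_le hM' hXP
  have b4 := norm_mul_le_of_le (norm_PiM_le hG hGu t)
    (norm_mul_le_of_le (le_refl ‖Vop G 0 * Theta G θ R‖) hP')
  have b := norm_add_le_of_le b1 (norm_mul_le_of_le hL
    (norm_add_le_of_le b2 (norm_mul_le_of_le hL (norm_add_le_of_le b3 b4))))
  rw [norm_smul, norm_inv, Complex.norm_ofNat]
  calc _ ≤ 2⁻¹ * _ := mul_le_mul_of_nonneg_left b (by norm_num)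
    _ = _ := by ring

theorem inv_sqrt_sq_add_le {c M t s : ℝ} (hc : 0 < c) (hM : 0 ≤ M) (h : |t - s| ≤ M)
    (hs : 0 < |s|) : (√(t ^ 2 + c))⁻¹ ≤ (1 + M / √c) / |s| := by
  have h1 : |t| ≤ √(t ^ 2 + c) := Real.abs_le_sqrt (by linarith)
  have h2 : √c ≤ √(t ^ 2 + c) := Real.sqrt_le_sqrt (by nlinarith)
  have h3 : 0 < √c := Real.sqrt_pos.2 hc
  have h4 : |s| ≤ |t| + M := by
    have := abs_sub_abs_le_abs_sub s t
    rw [abs_sub_comm] at this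
    linarith
  have h5 : M ≤ M / √c * √(t ^ 2 + c) := by
    calc M = M / √c * √c := (div_mul_cancel₀ _ h3.ne').symm
      _ ≤ _ := by gcongr
  rw [inv_le_comm₀ (h3.trans_le h2) (by positivity), inv_div, div_le_iff₀ (by positivity)]
  linarith

end OffDiagonal

/-- properties of `C̃(s) = Λ(s)⁻¹Π⁻(s)KΘ_RΠ⁺(s)` (Lemma 4.4). -/
theorem stmt_17 {K : Type*} [NormedAddCommGroup K] [InnerProductSpace ℂ K]
    [FiniteDimensional ℂ K]
    (G : K →L[ℂ] K) (hG : CommHyp G) (hGu : IsUnit G) (δ : ℝ) (f₁ f₂ : ℝ × ℝ → ℝ)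
    (hf₁ : C2Bdd f₁) (hf₂ : C2Bdd f₂) (θ : ℝ → ℝ) (hθ : IsCutoff θ)
    (R : ℝ) (hR : 0 < R) :
    ∃ C₀ > 0, ∀ u₀ : WithLp 2 (K × K), ∀ u : ℝ → WithLp 2 (K × K),
      Theta G θ R u₀ = u₀ → ‖u₀.fst‖ ^ 2 + ‖u₀.snd‖ ^ 2 = 1 →
      IsLZSol G δ f₁ f₂ u → u 0 = u₀ →
        (∀ s : ℝ,
          PiP G (sigma δ f₁ f₂ u s) ∘L Ctil G θ R δ f₁ f₂ u s
            ∘L PiP G (sigma δ f₁ f₂ u s) = 0 ∧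
          PiM G (sigma δ f₁ f₂ u s) ∘L Ctil G θ R δ f₁ f₂ u s
            ∘L PiM G (sigma δ f₁ f₂ u s) = 0) ∧
        (∀ s : ℝ,
          (2 : ℂ)⁻¹ • (Ctil G θ R δ f₁ f₂ u s
              - ContinuousLinearMap.adjoint (Ctil G θ R δ f₁ f₂ u s))
            = ((sigma δ f₁ f₂ u s / 2 : ℝ) : ℂ) •
                (LamInv G (sigma δ f₁ f₂ u s) ∘L LamInv G (sigma δ f₁ f₂ u s)
                  ∘L Theta G θ R ∘L Kcal G)) ∧
        (∀ s : ℝ, 1 ≤ |s| →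
          ‖Ctil G θ R δ f₁ f₂ u s‖ ≤ C₀ / |s| ∧
          ‖Btil G θ R δ f₁ f₂ u s‖ ≤ C₀ / s ^ 2 ∧
          ‖deriv (Btil G θ R δ f₁ f₂ u) s‖ ≤ C₀ / |s| ^ 3) := by
  obtain ⟨M, hM, hσ⟩ := exists_sigma_bound G δ hf₁.1 hf₂.1
  obtain ⟨c, hc, hcs⟩ := exists_pos_le_jointSpec hGu
  set D := 1 + M / √c with hD
  set κ := ‖Vop G 0 * Theta G θ R‖
  set N := 1 + M * (2 * ‖G‖)
  have hD0 : 0 ≤ D := by positivity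
  have hκ : 0 ≤ κ := norm_nonneg _
  have hN : 0 ≤ N := by positivity
  refine ⟨D * κ + D ^ 2 * κ + N * (2 * D ^ 3 * κ) + 1, by positivity, fun u₀ u _ hu₀ hu h0 =>
    ⟨PiP_mul_Ctil_mul_PiP hG hGu θ R δ f₁ f₂ u, Ctil_sub_adjoint hG θ R δ f₁ f₂ u,
      fun s hs => ?_⟩⟩
  obtain ⟨h1, σ', h2, h3⟩ := hσ u (h0 ▸ hu₀) hu s
  have hs0 : 0 < |s| := by linarith
  have hl := inv_sqrt_sq_add_le hc hM h1 hs0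
  refine ⟨?_, ?_, ?_⟩
  · calc _ ≤ _ := norm_Ctil_le hG hGu hc hcs θ R δ f₁ f₂ u s
      _ ≤ D / |s| * κ := by gcongr
      _ = D * κ / |s| := by ring
      _ ≤ _ := by
        gcongr
        linarith [show 0 ≤ D ^ 2 * κ by positivity, show 0 ≤ N * (2 * D ^ 3 * κ) by positivity]
  · calc _ ≤ _ := norm_Btil_le hG hGu hc hcs θ R δ f₁ f₂ u s
      _ ≤ (D / |s|) ^ 2 * κ := by gcongr
      _ = D ^ 2 * κ / s ^ 2 := by rw [div_pow, sq_abs]; ring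
      _ ≤ _ := by
        gcongr
        linarith [show 0 ≤ D * κ by positivity, show 0 ≤ N * (2 * D ^ 3 * κ) by positivity]
  · calc _ ≤ _ := norm_deriv_Btil_le hG hGu hc hcs θ R δ f₁ f₂ u h2
      _ ≤ N * (2 * (D / |s|) ^ 3 * κ) := by gcongr
      _ = N * (2 * D ^ 3 * κ) / |s| ^ 3 := by rw [div_pow]; ring
      _ ≤ _ := by
        gcongr
        linarith [show 0 ≤ D * κ by positivity, show 0 ≤ D ^ 2 * κ by positivity]

end
end
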